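/- Under the (P4+kP3)-free setup, suppose that no minimum total dominating set of G contains a P3, and let D be a minimum total dominating set of G. Say that a B−C-edge xy of D with x ∈ B and y ∈ C can be turned into a C-edge if there exists a vertex z ∈ C such that (D∖{x})∪{z} is a total dominating set of G. Then the number of B−C-edges of D that cannot be turned into C-edges is at most k+|A|. -/

import Mathlib

open SimpleGraph

namespace TD

variable {V : Type*} {α β : Type*}

/-- `D` is a total dominating set of `G`: every vertex has a neighbor in `D`. -/
def IsTotalDomSet (G : SimpleGraph V) (D : Set V) : Prop :=
  ∀ v : V, ∃ u ∈ D, G.Adj v u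

/-- The total domination number `γ_t(G)`. -/
noncomputable def totalDomNum (G : SimpleGraph V) : ℕ :=
  sInf {m : ℕ | ∃ D : Set V, IsTotalDomSet G D ∧ D.ncard = m}

/-- A minimum total dominating set. -/
def IsMinTotalDomSet (G : SimpleGraph V) (D : Set V) : Prop :=
  IsTotalDomSet G D ∧ D.ncard = totalDomNum G

/-- `S` contains a `P3`: three distinct vertices `a, b, c ∈ S` with `ab, bc ∈ E(G)`. -/
def HasP3 (G : SimpleGraph V) (S : Set V) : Prop :=
  ∃ a b c : V, a ∈ S ∧ b ∈ S ∧ c ∈ S ∧ a ≠ b ∧ b ≠ c ∧ a ≠ c ∧ G.Adj a b ∧ G.Adj b c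

/-- `D` is a dominating set of `G`. -/
def IsDomSet (G : SimpleGraph V) (D : Set V) : Prop :=
  ∀ v ∉ D, ∃ u ∈ D, G.Adj v u

/-- The domination number `γ(G)`. -/
noncomputable def domNum (G : SimpleGraph V) : ℕ :=
  sInf {m : ℕ | ∃ D : Set V, IsDomSet G D ∧ D.ncard = m}

/-- The (open) neighborhood of a set `S`: union of the neighborhoods of its members. -/
def nbhd (G : SimpleGraph V) (S : Set V) : Set V :=
  {v | ∃ u ∈ S, G.Adj u v}

/-- The closed neighborhood `N[S]`. -/
def closedNbhd (G : SimpleGraph V) (S : Set V) : Set V :=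
  S ∪ nbhd G S

/-- Distance between two sets of vertices. -/
noncomputable def setDist (G : SimpleGraph V) (S T : Set V) : ℕ :=
  sInf {m : ℕ | ∃ u ∈ S, ∃ v ∈ T, G.dist u v = m}

/-- `k` disjoint copies of `H`. -/
def kCopies (k : ℕ) (H : SimpleGraph α) : SimpleGraph (Fin k × α) where
  Adj p q := p.1 = q.1 ∧ H.Adj p.2 q.2
  symm := ⟨fun _ _ h => ⟨h.1.symm, h.2.symm⟩⟩
  loopless := ⟨fun p h => H.loopless.irrefl p.2 h.2⟩

/-- The graph `P4 + k·P3`. -/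
def p4kp3 (k : ℕ) : SimpleGraph (Fin 4 ⊕ (Fin k × Fin 3)) :=
  (pathGraph 4) ⊕g (kCopies k (pathGraph 3))

/-- `G` contains no induced copy of `H` (`G` is `H`-free). -/
def IndFree (G : SimpleGraph V) (H : SimpleGraph α) : Prop :=
  ¬ Nonempty (H ↪g G)

/-- `K` is a maximal clique of the subgraph of `G` induced by `C`. -/
def IsMaxCliqueWithin (G : SimpleGraph V) (C K : Set V) : Prop :=
  K ⊆ C ∧ G.IsClique K ∧ ∀ K' : Set V, K' ⊆ C → G.IsClique K' → K ⊆ K' → K' = K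

/-- Member of `𝒦'`: a maximal clique of `G[C]` whose closed neighborhood contains no
induced `P4` and such that no vertex of `B` is adjacent to all of its vertices. -/
def GoodClique (G : SimpleGraph V) (B C K : Set V) : Prop :=
  IsMaxCliqueWithin G C K ∧
    IndFree (G.induce (closedNbhd G K)) (pathGraph 4) ∧
    ¬ ∃ b ∈ B, ∀ x ∈ K, G.Adj b x

/-- A regular clique: a member of `𝒦'` for which there are `k` other members of `𝒦'`
pairwise at distance at least four from one another and from it. -/
def RegularClique (G : SimpleGraph V) (k : ℕ) (B C K : Set V) : Prop :=
  GoodClique G B C K ∧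
    ∃ Ks : Fin k → Set V,
      (∀ i, GoodClique G B C (Ks i)) ∧
      (∀ i, 4 ≤ setDist G K (Ks i)) ∧
      ∀ i j : Fin k, i ≠ j → 4 ≤ setDist G (Ks i) (Ks j)

/-- `w` is a private neighbor of `v` with respect to `D`: `N(w) ∩ D = {v}`. -/
def IsPrivateNbr (G : SimpleGraph V) (D : Set V) (v w : V) : Prop :=
  {u | u ∈ D ∧ G.Adj w u} = {v}

end TD

open TD SimpleGraph

namespace TD

variable {V : Type*} {G : SimpleGraph V}

/-- An induced path on three vertices, as an embedding. -/
def pathThree {a b c : V} (hab : G.Adj a b) (hbc : G.Adj b c) (hac : ¬ G.Adj a c) (hne : a ≠ c) :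
    pathGraph 3 ↪g G where
  toFun := ![a, b, c]
  inj' := by
    intro i j h
    have h1 := hab.ne
    have h2 := hbc.ne
    fin_cases i <;> fin_cases j <;> simp_all
  map_rel_iff' := by
    intro i j
    change G.Adj (![a, b, c] i) (![a, b, c] j) ↔ _
    have h1 := hab.symm
    have h2 := hbc.symm
    have h3 : ¬ G.Adj c a := fun h => hac h.symm
    fin_cases i <;> fin_cases j <;> simp_all [pathGraph_adj]

/-- An induced path on four vertices, as an embedding. -/
def pathFour {a b c d : V} (hab : G.Adj a b) (hbc : G.Adj b c) (hcd : G.Adj c d)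
    (hac : ¬ G.Adj a c) (had : ¬ G.Adj a d) (hbd : ¬ G.Adj b d) :
    pathGraph 4 ↪g G where
  toFun := ![a, b, c, d]
  inj' := by
    have h1 := hab.ne
    have h2 := hbc.ne
    have h3 := hcd.ne
    have h4 : a ≠ c := by rintro rfl; exact had hcd
    have h5 : a ≠ d := by rintro rfl; exact hac hcd.symm
    have h6 : b ≠ d := by rintro rfl; exact had hab
    intro i j h
    fin_cases i <;> fin_cases j <;> simp_all
  map_rel_iff' := by
    intro i j
    change G.Adj (![a, b, c, d] i) (![a, b, c, d] j) ↔ _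
    have h1 := hab.symm
    have h2 := hbc.symm
    have h3 := hcd.symm
    have h4 : ¬ G.Adj c a := fun h => hac h.symm
    have h5 : ¬ G.Adj d a := fun h => had h.symm
    have h6 : ¬ G.Adj d b := fun h => hbd h.symm
    fin_cases i <;> fin_cases j <;> simp_all [pathGraph_adj]

/-- Pairwise disjoint and anticomplete induced paths, one `P4` and `k` copies of `P3`,
assemble to an induced `P4 + k·P3`. -/
theorem not_indFree_p4kp3 {k : ℕ} (f : pathGraph 4 ↪g G) (g : Fin k → (pathGraph 3 ↪g G))
    (hfg : ∀ i p j, f i ≠ g p j ∧ ¬ G.Adj (f i) (g p j))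
    (hgg : ∀ p q, p ≠ q → ∀ i j, g p i ≠ g q j ∧ ¬ G.Adj (g p i) (g q j)) :
    ¬ IndFree G (p4kp3 k) := by
  refine not_not_intro ⟨⟨⟨Sum.elim f fun p => g p.1 p.2, ?_⟩, ?_⟩⟩
  · rintro (i | ⟨p, i⟩) (j | ⟨q, j⟩) h
    · exact congrArg Sum.inl (f.injective h)
    · exact absurd h (hfg i q j).1
    · exact absurd h.symm (hfg j p i).1
    · by_cases hpq : p = q
      · subst hpq
        exact congrArg (fun t => Sum.inr (p, t)) ((g p).injective h)
      · exact absurd h (hgg p q hpq i j).1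
  · rintro (i | ⟨p, i⟩) (j | ⟨q, j⟩)
    · change G.Adj (f i) (f j) ↔ _
      simp [p4kp3]
    · change G.Adj (f i) (g q j) ↔ _
      simpa [p4kp3] using (hfg i q j).2
    · change G.Adj (g p i) (f j) ↔ _
      simpa [p4kp3] using fun h : G.Adj (g p i) (f j) => (hfg j p i).2 h.symm
    · change G.Adj (g p i) (g q j) ↔ _
      by_cases hpq : p = q
      · subst hpq
        simp [p4kp3, kCopies]
      · simpa [p4kp3, kCopies, hpq] using (hgg p q hpq i j).2

/-- Attaching an induced `P3` anticomplete to an induced `P4 + n·P3`. -/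
theorem not_indFree_p4kp3_succ {n : ℕ} (φ : p4kp3 n ↪g G) (h : pathGraph 3 ↪g G)
    (hφ : ∀ v j, φ v ≠ h j ∧ ¬ G.Adj (φ v) (h j)) : ¬ IndFree G (p4kp3 (n + 1)) := by
  let inP4 : pathGraph 4 ↪g p4kp3 n :=
    ⟨⟨Sum.inl, Sum.inl_injective⟩, by simp [p4kp3]⟩
  let inP3 (p : Fin n) : pathGraph 3 ↪g p4kp3 n :=
    ⟨⟨fun i => Sum.inr (p, i), fun i j h => by simpa using h⟩, fun {i j} => by
      change (p4kp3 n).Adj (Sum.inr (p, i)) (Sum.inr (p, j)) ↔ _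
      simp [p4kp3, kCopies]⟩
  refine not_indFree_p4kp3 (φ.comp inP4) (Fin.cons h fun p => φ.comp (inP3 p)) ?_ ?_
  · intro i p j
    refine Fin.cases ?_ (fun p => ?_) p
    · exact hφ _ j
    · refine ⟨fun h => ?_, fun h => ?_⟩
      · have := φ.injective h
        simp [inP4, inP3] at this
      · have := φ.map_rel_iff.1 h
        simp [inP4, inP3, p4kp3] at this
  · intro p q
    refine Fin.cases (Fin.cases ?_ (fun q => ?_) q) (fun p => Fin.cases ?_ (fun q => ?_) q) p
    · exact fun h => absurd rfl h
    · exact fun _ i j => ⟨fun e => (hφ _ i).1 e.symm, fun e => (hφ _ i).2 e.symm⟩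
    · exact fun _ i j => hφ _ j
    · intro hpq i j
      have hpq' : p ≠ q := fun e => hpq (congrArg Fin.succ e)
      refine ⟨fun h => ?_, fun h => ?_⟩
      · have : (Sum.inr (p, i) : Fin 4 ⊕ (Fin n × Fin 3)) = Sum.inr (q, j) := φ.injective h
        simp [hpq'] at this
      · have : (p4kp3 n).Adj (Sum.inr (p, i)) (Sum.inr (q, j)) := φ.map_rel_iff.1 h
        simp [p4kp3, kCopies, hpq'] at this

theorem p4kp3_exists_adj {n : ℕ} (v : Fin 4 ⊕ (Fin n × Fin 3)) : ∃ u, (p4kp3 n).Adj v u := by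
  rcases v with i | ⟨p, i⟩
  · have : ∃ j, (pathGraph 4).Adj i j := by
      simp only [pathGraph_adj]; revert i; decide
    obtain ⟨j, hj⟩ := this
    exact ⟨Sum.inl j, by simpa [p4kp3] using hj⟩
  · have : ∃ j, (pathGraph 3).Adj i j := by
      simp only [pathGraph_adj]; revert i; decide
    obtain ⟨j, hj⟩ := this
    exact ⟨Sum.inr (p, j), by simpa [p4kp3, kCopies] using hj⟩

theorem IsTotalDomSet.totalDomNum_le {D : Set V} (h : IsTotalDomSet G D) :
    totalDomNum G ≤ D.ncard :=
  Nat.sInf_le ⟨D, h, rfl⟩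

/-- In a `P3`-free total dominating set, every vertex has at most one neighbor. -/
theorem eq_of_adj_of_not_hasP3 {D : Set V} (h : ¬ HasP3 G D) {a b c : V}
    (ha : a ∈ D) (hb : b ∈ D) (hc : c ∈ D) (hab : G.Adj b a) (hbc : G.Adj b c) : a = c := by
  by_contra hne
  exact h ⟨a, b, c, ha, hb, hc, hab.ne', hbc.ne, hne, hab.symm, hbc⟩

/-- Exchange argument: if `A` dominates everything outside `C` and contains a `P3`, then the
private neighbors in `C` of more than `|A|` independent vertices of a minimum total dominating
set cannot all be adjacent to a single vertex `w`. -/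
theorem ncard_le_of_private_adj [Finite V] {A C D Y : Set V}
    (hnoP3 : ∀ D' : Set V, IsMinTotalDomSet G D' → ¬ HasP3 G D')
    (hD : IsMinTotalDomSet G D) (hAdom : ∀ v ∉ C, ∃ a ∈ A, G.Adj v a) (hAP3 : HasP3 G A)
    (hYD : Y ⊆ D) (hY : ∀ v ∈ C, ∀ y ∈ Y, ∀ y' ∈ Y, G.Adj v y → G.Adj v y' → y = y')
    (w : V) (hw : ∀ y ∈ Y, ∀ u ∈ C, IsPrivateNbr G D y u → G.Adj u w) :
    Y.ncard ≤ A.ncard := by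
  by_contra! hlt
  let D' := (D \ Y) ∪ (A ∪ {w})
  have hdom : IsTotalDomSet G D' := by
    intro v
    by_cases hvC : v ∈ C
    · obtain ⟨d, hd, hvd⟩ := hD.1 v
      by_cases hdY : d ∈ Y
      · by_cases hpriv : IsPrivateNbr G D d v
        · exact ⟨w, by simp [D'], hw d hdY v hvC hpriv⟩
        · obtain ⟨d', hd', hvd', hne⟩ : ∃ d' ∈ D, G.Adj v d' ∧ d' ≠ d := by
            by_contra! hcon
            refine hpriv (Set.ext fun u => ⟨fun hu => hcon u hu.1 hu.2, ?_⟩)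
            rintro rfl
            exact ⟨hd, hvd⟩
          exact ⟨d', Or.inl ⟨hd', fun h => hne (hY v hvC _ h _ hdY hvd' hvd)⟩, hvd'⟩
      · exact ⟨d, Or.inl ⟨hd, hdY⟩, hvd⟩
    · obtain ⟨a, ha, hva⟩ := hAdom v hvC
      exact ⟨a, Or.inr (Or.inl ha), hva⟩
  have hcard : D'.ncard ≤ D.ncard := by
    have h1 : D'.ncard ≤ (D \ Y).ncard + (A ∪ {w}).ncard := Set.ncard_union_le _ _
    have h2 : (A ∪ {w}).ncard ≤ A.ncard + ({w} : Set V).ncard := Set.ncard_union_le _ _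
    have h3 := Set.ncard_sdiff_add_ncard_of_subset hYD (Set.toFinite D)
    rw [Set.ncard_singleton] at h2
    omega
  have hmin : IsMinTotalDomSet G D' :=
    ⟨hdom, le_antisymm (hcard.trans hD.2.le) hdom.totalDomNum_le⟩
  obtain ⟨a, b, c, ha, hb, hc, h⟩ := hAP3
  exact hnoP3 D' hmin ⟨a, b, c, Or.inr (Or.inl ha), Or.inr (Or.inl hb), Or.inr (Or.inl hc), h⟩

end TD

theorem stmt14 {V : Type*} [Fintype V] (k : ℕ) (hk : 1 ≤ k)
    (G : SimpleGraph V) (hconn : G.Connected) (hfree : IndFree G (p4kp3 k))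
    (A B C : Set V) (hA : Nonempty (G.induce A ≃g p4kp3 (k - 1)))
    (hB : B = {v | v ∉ A ∧ ∃ a ∈ A, G.Adj v a})
    (hC : C = {v | v ∉ A ∧ v ∉ B})
    (hnoP3 : ∀ D' : Set V, IsMinTotalDomSet G D' → ¬ HasP3 G D')
    (D : Set V) (hD : IsMinTotalDomSet G D) :
    ({e : Sym2 V | ∃ x y : V, e = s(x, y) ∧ G.Adj x y ∧ x ∈ D ∧ y ∈ D ∧ x ∈ B ∧ y ∈ C ∧
        ¬ ∃ z ∈ C, IsTotalDomSet G ((D \ {x}) ∪ {z})}).ncard ≤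
      k + A.ncard := by
  classical
  obtain ⟨ψ⟩ := hA
  obtain ⟨n, rfl⟩ : ∃ n, k = n + 1 := ⟨k - 1, by omega⟩
  rw [Nat.add_sub_cancel] at ψ
  let φ : p4kp3 n ↪g G := (SimpleGraph.Embedding.induce A).comp ψ.symm.toEmbedding
  have hφA : ∀ v, φ v ∈ A := fun v => (ψ.symm v).2
  have hAφ : ∀ a ∈ A, ∃ v, φ v = a := fun a ha =>
    ⟨ψ ⟨a, ha⟩, by simp [φ]⟩
  have hCA : ∀ v ∈ C, ∀ a ∈ A, a ≠ v ∧ ¬ G.Adj a v := by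
    intro v hv a ha
    rw [hC] at hv
    refine ⟨fun h => hv.1 (h ▸ ha), fun h => hv.2 ?_⟩
    rw [hB]
    exact ⟨hv.1, a, ha, h.symm⟩
  have hBC : ∀ v ∈ C, v ∉ B := fun v hv => by
    rw [hC] at hv
    exact hv.2
  -- `G[C]` is a disjoint union of cliques
  have hclique : ∀ a ∈ C, ∀ b ∈ C, ∀ c ∈ C, G.Adj a b → G.Adj b c → a ≠ c → G.Adj a c := by
    intro a ha b hb c hc hab hbc hne
    by_contra hac
    refine not_indFree_p4kp3_succ φ (pathThree hab hbc hac hne) (fun v j => ?_) hfree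
    refine hCA _ ?_ _ (hφA v)
    change ![a, b, c] j ∈ C
    fin_cases j <;> simp [ha, hb, hc]
  have hAdom : ∀ v ∉ C, ∃ a ∈ A, G.Adj v a := by
    intro v hv
    by_cases hvA : v ∈ A
    · obtain ⟨t, rfl⟩ := hAφ v hvA
      obtain ⟨u, hu⟩ := p4kp3_exists_adj t
      exact ⟨φ u, hφA u, φ.map_rel_iff.2 hu⟩
    · have hvB : v ∈ B := by
        by_contra h
        exact hv (by rw [hC]; exact ⟨hvA, h⟩)
      rw [hB] at hvB
      exact hvB.2
  have hAP3 : HasP3 G A := by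
    refine ⟨φ (.inl 0), φ (.inl 1), φ (.inl 2), hφA _, hφA _, hφA _, ?_, ?_, ?_, ?_, ?_⟩
    · exact fun h => by simpa using φ.injective h
    · exact fun h => by simpa using φ.injective h
    · exact fun h => by simpa using φ.injective h
    · exact φ.map_rel_iff.2 (by simp [p4kp3, pathGraph_adj])
    · exact φ.map_rel_iff.2 (by simp [p4kp3, pathGraph_adj])
  have hDP3 := hnoP3 D hD
  choose p hpD hp using hD.1
  have huniq : ∀ v ∈ D, ∀ u ∈ D, G.Adj v u → u = p v := fun v hv u hu h =>
    eq_of_adj_of_not_hasP3 hDP3 hu hv (hpD v) h (hp v)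
  let Y : Set V := {y | y ∈ D ∧ y ∈ C ∧ p y ∈ B ∧
    ∀ z ∈ C, ¬ IsTotalDomSet G ((D \ {p y}) ∪ {z})}
  suffices hYcard : Y.ncard ≤ n + 1 + A.ncard by
    refine le_trans (le_trans (Set.ncard_le_ncard ?_ (Set.toFinite _))
      (Set.ncard_image_le (f := fun y => s(p y, y)) (Set.toFinite Y))) hYcard
    rintro e ⟨x, y, rfl, hxy, hx, hy, hxB, hyC, hz⟩
    obtain rfl := huniq y hy x hx hxy.symm
    exact ⟨y, ⟨hy, hyC, hxB, fun z hz' h => hz ⟨z, hz', h⟩⟩, rfl⟩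
  by_contra! hlt
  have hYY : ∀ y ∈ Y, ∀ y' ∈ Y, ¬ G.Adj y y' := by
    intro y hy y' hy' h
    refine hBC y' hy'.2.1 ?_
    rw [huniq y hy.1 y' hy'.1 h]
    exact hy.2.2.1
  have hinj : ∀ v ∈ C, ∀ y ∈ Y, ∀ y' ∈ Y, G.Adj v y → G.Adj v y' → y = y' := by
    intro v hv y hy y' hy' h h'
    by_contra hne
    exact hYY y hy y' hy' (hclique y hy.2.1 v hv y' hy'.2.1 h.symm h' hne)
  have hJ : ∀ w, {y ∈ Y | ∀ u ∈ C, IsPrivateNbr G D y u → G.Adj u w}.ncard ≤ A.ncard :=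
    fun w => ncard_le_of_private_adj hnoP3 hD hAdom hAP3 (fun y hy => hy.1.1)
      (fun v hv y hy y' hy' => hinj v hv y hy.1 y' hy'.1) w fun y hy => hy.2
  let L : V → Set V := fun w => {y ∈ Y | ∃ u ∈ C, IsPrivateNbr G D y u ∧ ¬ G.Adj u w}
  have hL : ∀ w, n + 1 < (L w).ncard := by
    intro w
    have hsub : Y ⊆ {y ∈ Y | ∀ u ∈ C, IsPrivateNbr G D y u → G.Adj u w} ∪ L w := by
      intro y hy
      by_cases h : ∀ u ∈ C, IsPrivateNbr G D y u → G.Adj u w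
      · exact Or.inl ⟨hy, h⟩
      · push Not at h
        exact Or.inr ⟨hy, h⟩
    have h1 := Set.ncard_le_ncard hsub (Set.toFinite _)
    have h2 := Set.ncard_union_le {y ∈ Y | ∀ u ∈ C, IsPrivateNbr G D y u → G.Adj u w} (L w)
    have h3 := hJ w
    omega
  have hpriv : ∀ {y u : V}, IsPrivateNbr G D y u → G.Adj u y ∧ ∀ d ∈ D, G.Adj u d → d = y :=
    fun {y u} h => ⟨((Set.ext_iff.1 h y).2 rfl).2, fun d hd hud => (Set.ext_iff.1 h d).1 ⟨hd, hud⟩⟩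
  have hpy : ∀ y ∈ Y, ∀ y' ∈ Y, p y ≠ y' := fun y hy y' hy' h =>
    hBC y' hy'.2.1 (h ▸ hy.2.2.1)
  -- an index whose edge extends to an induced `P4`
  obtain ⟨y₀, hy₀, u₀, hu₀C, hu₀, -⟩ : (L hconn.nonempty.some).Nonempty := by
    rw [← Set.ncard_pos (Set.toFinite _)]
    have := hL hconn.nonempty.some
    omega
  have hu₀y := (hpriv hu₀).1
  obtain ⟨w, hw⟩ := not_forall.1 (hy₀.2.2.2 u₀ hu₀C)
  have hwu : ¬ G.Adj w u₀ := fun h => hw ⟨u₀, Or.inr rfl, h⟩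
  have hwD : ∀ d ∈ D, G.Adj w d → d = p y₀ := by
    intro d hd h
    by_contra hne
    exact hw ⟨d, Or.inl ⟨hd, hne⟩, h⟩
  have hwp : G.Adj w (p y₀) := by
    have := hwD _ (hpD w) (hp w)
    exact this ▸ hp w
  have hwy : ∀ y ∈ Y, ¬ G.Adj w y := fun y hy h => hpy y₀ hy₀ y hy (hwD y hy.1 h).symm
  have hup : ∀ {y u : V}, IsPrivateNbr G D y u → y ∈ Y → ∀ y' ∈ Y, ¬ G.Adj (p y') u :=
    fun {y u} h hy y' hy' hadj => hpy y' hy' y hy ((hpriv h).2 _ (hpD y') hadj.symm)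
  have hp_inj : ∀ y ∈ Y, ∀ y' ∈ Y, p y = p y' → y = y' := by
    intro y hy y' hy' h
    exact eq_of_adj_of_not_hasP3 hDP3 hy.1 (hpD y) hy'.1 (hp y).symm (h ▸ (hp y').symm)
  have hpp : ∀ y ∈ Y, ∀ y' ∈ Y, ¬ G.Adj (p y) (p y') := by
    intro y hy y' hy' h
    have := eq_of_adj_of_not_hasP3 hDP3 hy.1 (hpD y) (hpD y') (hp y).symm h
    exact hpy y' hy' y hy this.symm
  have hpyadj : ∀ y ∈ Y, ∀ y' ∈ Y, y ≠ y' → ¬ G.Adj (p y) y' := by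
    intro y hy y' hy' hne h
    exact hne (eq_of_adj_of_not_hasP3 hDP3 hy.1 (hpD y) hy'.1 (hp y).symm h)
  let f := pathFour hwp (hp y₀).symm hu₀y.symm (hwy y₀ hy₀) hwu (hup hu₀ hy₀ y₀ hy₀)
  have hcard : n + 1 ≤ (L w \ {y₀}).ncard := by
    have h1 := hL w
    have h2 := Set.ncard_le_ncard_sdiff_add_ncard (L w) {y₀} (Set.toFinite _)
    rw [Set.ncard_singleton] at h2
    omega
  obtain ⟨ι⟩ : Nonempty (Fin (n + 1) ↪ ↥(L w \ {y₀})) := by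
    refine Function.Embedding.nonempty_of_card_le ?_
    rw [Fintype.card_fin, ← Nat.card_eq_fintype_card]
    exact hcard
  choose u huC hu huw using fun i => (ι i).2.1.2
  have hyY : ∀ i, (ι i : V) ∈ Y := fun i => (ι i).2.1.1
  have hy0 : ∀ i, y₀ ≠ ι i := fun i h => (ι i).2.2 h.symm
  have hne : ∀ i, p (ι i) ≠ u i := fun i h => by
    refine hBC _ (huC i) ?_
    rw [← h]
    exact (hyY i).2.2.1
  let g : Fin (n + 1) → (pathGraph 3 ↪g G) := fun i =>
    pathThree (hp (ι i)).symm (hpriv (hu i)).1.symm (hup (hu i) (hyY i) _ (hyY i)) (hne i)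
  -- edges `s(p y, y)` extended by a private neighbor in `C` are pairwise anticomplete
  have hsep : ∀ y ∈ Y, ∀ y' ∈ Y, y ≠ y' → ∀ u ∈ C, ∀ u' ∈ C, IsPrivateNbr G D y u →
      IsPrivateNbr G D y' u' → ∀ a ∈ ({p y, y, u} : Set V), ∀ b ∈ ({p y', y', u'} : Set V),
      a ≠ b ∧ ¬ G.Adj a b := by
    intro y hy y' hy' hyy' u huC u' hu'C hu hu'
    have key : ∀ a ∈ ({p y, y, u} : Set V), ∀ b ∈ ({p y', y', u'} : Set V), ¬ G.Adj a b := by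
      rintro a (rfl | rfl | rfl) b (rfl | rfl | rfl)
      · exact hpp _ hy _ hy'
      · exact hpyadj _ hy _ hy' hyy'
      · exact hup hu' hy' _ hy
      · exact fun h => hpyadj _ hy' _ hy hyy'.symm h.symm
      · exact hYY _ hy _ hy'
      · exact fun h => hyy' ((hpriv hu').2 _ hy.1 h.symm)
      · exact fun h => hup hu hy _ hy' h.symm
      · exact fun h => hyy' ((hpriv hu).2 _ hy'.1 h).symm
      · intro h
        have h1 := (hpriv hu).1
        by_cases e : y = b
        · subst e
          exact hYY _ hy _ hy' (hpriv hu').1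
        · exact hyy' ((hpriv hu').2 _ hy.1
            (hclique _ hy.2.1 _ huC _ hu'C h1.symm h e).symm)
    intro a ha b hb
    refine ⟨?_, key a ha b hb⟩
    intro hab
    rw [hab] at ha
    rcases hb with h | h | h <;> rw [h] at ha
    · exact key _ ha y' (by simp) (hp y').symm
    · exact key _ ha (p y') (by simp) (hp _)
    · exact key _ ha y' (by simp) (hpriv hu').1
  have hg : ∀ i j, g i j ∈ ({p (ι i), (ι i : V), u i} : Set V) := by
    intro i j
    change ![p (ι i), (ι i : V), u i] j ∈ _
    fin_cases j <;> simp
  have hf : ∀ j, f j = w ∨ f j ∈ ({p y₀, y₀, u₀} : Set V) := by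
    intro j
    change ![w, p y₀, y₀, u₀] j = w ∨ ![w, p y₀, y₀, u₀] j ∈ ({p y₀, y₀, u₀} : Set V)
    fin_cases j <;> simp
  have hwsep : ∀ i, ∀ b ∈ ({p (ι i), (ι i : V), u i} : Set V), w ≠ b ∧ ¬ G.Adj w b := by
    intro i
    have hsp := hsep _ hy₀ _ (hyY i) (hy0 i) _ hu₀C _ (huC i) hu₀ (hu i) (p y₀) (by simp)
    rintro b hb
    refine ⟨fun h => (hsp b hb).2 (h ▸ hwp.symm), ?_⟩
    rcases hb with rfl | rfl | rfl
    · exact fun h => hy0 i (hp_inj _ hy₀ _ (hyY i) (hwD _ (hpD _) h).symm)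
    · exact hwy _ (hyY i)
    · exact fun h => huw i h.symm
  refine not_indFree_p4kp3 f g (fun j i t => ?_) (fun i i' hii' s t => ?_) hfree
  · rcases hf j with h | h
    · rw [h]
      exact hwsep i _ (hg i t)
    · exact hsep _ hy₀ _ (hyY i) (hy0 i) _ hu₀C _ (huC i) hu₀ (hu i) _ h _ (hg i t)
  · exact hsep _ (hyY i) _ (hyY i') (fun h => hii' (ι.injective (Subtype.ext h))) _ (huC i) _
      (huC i') (hu i) (hu i') _ (hg i s) _ (hg i' t)
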